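/- arXiv:1801.07120 — 2 statements merged into one kernel-verified Lean document; each statement's English description precedes it below -/
import Mathlib

section
/- Define h(i, j) = ∑_{d ∣ gcd(i,j), gcd(d, i/d) = gcd(d, j/d)} φ(d)/φ(d / gcd(d, i/d)). Then for positive integers m, n, the number of subrings (additive subgroups closed under multiplication) of the ring ℤ_m × ℤ_n equals ∑_{i ∣ m} ∑_{j ∣ n} h(i, j). -/
/-- The arithmetic function h of the paper. -/
def h (i j : ℕ) : ℕ :=
  ∑ d ∈ ((Nat.gcd i j).divisors.filter
      (fun d => Nat.gcd d (i / d) = Nat.gcd d (j / d))),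
    Nat.totient d / Nat.totient (d / Nat.gcd d (i / d))

/-- good units -/
def gu (x y d : ℕ) : Finset ℕ :=
  (Finset.range d).filter (fun u => Nat.Coprime u d ∧ (d : ℤ) ∣ (u : ℤ) * y - x)

theorem fib_card (d e : ℕ) [NeZero d] [NeZero e] (hed : e ∣ d) (c : (ZMod e)ˣ) :
    (Finset.univ.filter (fun u : (ZMod d)ˣ => ZMod.unitsMap hed u = c)).card
      = Nat.totient d / Nat.totient e := by
  have hs := ZMod.unitsMap_surjective hed
  have h1 : ∀ c' : (ZMod e)ˣ,
      (Finset.univ.filter (fun u : (ZMod d)ˣ => ZMod.unitsMap hed u = c')).card =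
      (Finset.univ.filter (fun u : (ZMod d)ˣ => ZMod.unitsMap hed u = c)).card := by
    intro c'
    exact MonoidHom.card_fiber_eq_of_mem_range _ (hs c') (hs c)
  have h2 := Finset.card_eq_sum_card_fiberwise (f := ZMod.unitsMap hed)
    (s := Finset.univ) (t := Finset.univ) (fun _ _ => by simp)
  rw [Finset.sum_congr rfl (fun c' _ => h1 c')] at h2
  rw [Finset.sum_const, Finset.card_univ, Finset.card_univ, ZMod.card_units_eq_totient,
    ZMod.card_units_eq_totient, smul_eq_mul] at h2
  rw [h2, Nat.mul_div_cancel_left _ (Nat.totient_pos.2 (Nat.pos_of_ne_zero (NeZero.ne e)))]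

theorem gu_card_units (x y d : ℕ) [NeZero d] : (gu x y d).card =
    (Finset.univ.filter (fun u : (ZMod d)ˣ => (u : ZMod d) * y = x)).card := by
  symm
  apply Finset.card_bij (fun (u : (ZMod d)ˣ) _ => (u : ZMod d).val)
  · intro u hu
    simp only [Finset.mem_filter, Finset.mem_univ, true_and] at hu
    simp only [gu, Finset.mem_filter, Finset.mem_range]
    refine ⟨ZMod.val_lt _, ZMod.val_coe_unit_coprime u, ?_⟩
    rw [← ZMod.intCast_zmod_eq_zero_iff_dvd]
    push_cast
    rw [ZMod.natCast_zmod_val, hu, sub_self]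
  · intro u _ v _ huv
    exact Units.ext (ZMod.val_injective d huv)
  · intro b hb
    simp only [gu, Finset.mem_filter, Finset.mem_range] at hb
    obtain ⟨h1, h2, h3⟩ := hb
    refine ⟨ZMod.unitOfCoprime b h2, ?_, ?_⟩
    · simp only [Finset.mem_filter, Finset.mem_univ, true_and, ZMod.coe_unitOfCoprime]
      rw [← ZMod.intCast_zmod_eq_zero_iff_dvd] at h3
      push_cast at h3
      exact sub_eq_zero.1 h3
    · rw [ZMod.coe_unitOfCoprime, ZMod.val_natCast_of_lt h1]

theorem gu_card (x y d : ℕ) (hd : 0 < d) : (gu x y d).card =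
    if Nat.gcd d x = Nat.gcd d y then Nat.totient d / Nat.totient (d / Nat.gcd d x) else 0 := by
  have : NeZero d := ⟨hd.ne'⟩
  split_ifs with hg
  · rw [gu_card_units]
    obtain ⟨t, ht⟩ : ∃ t, t = Nat.gcd d x := ⟨_, rfl⟩
    have htp : 0 < t := ht ▸ Nat.gcd_pos_of_pos_left _ hd
    have hcx : Nat.Coprime (d / t) (x / t) := by
      rw [ht]; exact Nat.coprime_div_gcd_div_gcd (ht ▸ htp)
    have hcy : Nat.Coprime (d / t) (y / t) := by
      rw [ht, hg]; exact Nat.coprime_div_gcd_div_gcd (hg ▸ ht ▸ htp)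
    obtain ⟨e, he⟩ : t ∣ d := ht ▸ Nat.gcd_dvd_left _ _
    obtain ⟨x', hx'⟩ : t ∣ x := ht ▸ Nat.gcd_dvd_right _ _
    obtain ⟨y', hy'⟩ : t ∣ y := ht ▸ hg ▸ Nat.gcd_dvd_right _ _
    rw [← ht]
    have h1 : d / t = e := by rw [he, Nat.mul_div_cancel_left _ htp]
    have h2 : x / t = x' := by rw [hx', Nat.mul_div_cancel_left _ htp]
    have h3 : y / t = y' := by rw [hy', Nat.mul_div_cancel_left _ htp]
    rw [h1, h2] at hcx
    rw [h1, h3] at hcy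
    rw [h1]
    have hed : e ∣ d := ⟨t, by rw [he, mul_comm]⟩
    have : NeZero e := ⟨by rintro rfl; simp at he; omega⟩
    rw [← fib_card d e hed (ZMod.unitOfCoprime x' hcx.symm * (ZMod.unitOfCoprime y' hcy.symm)⁻¹)]
    congr 1
    ext u
    simp only [Finset.mem_filter, Finset.mem_univ, true_and]
    rw [eq_mul_inv_iff_mul_eq, Units.ext_iff]
    simp only [Units.val_mul, ZMod.coe_unitOfCoprime, ZMod.unitsMap_val]
    obtain ⟨b, hb⟩ : ∃ b : ℕ, (u : ZMod d) = b := ⟨(u : ZMod d).val, by simp⟩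
    rw [hb, ZMod.cast_natCast hed, ← Nat.cast_mul, ← Nat.cast_mul, ZMod.natCast_eq_natCast_iff,
      ZMod.natCast_eq_natCast_iff, hx', hy']
    rw [show b * (t * y') = t * (b * y') by ring]
    conv_lhs => rw [he]
    exact Nat.ModEq.mul_left_cancel_iff' htp.ne'
  · rw [Finset.card_eq_zero, Finset.eq_empty_iff_forall_notMem]
    intro u hu
    apply hg
    simp only [gu, Finset.mem_filter, Finset.mem_range] at hu
    obtain ⟨-, h2, h3⟩ := hu
    have h4 : x ≡ u * y [MOD d] := by
      rw [← Int.natCast_modEq_iff]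
      exact (Int.modEq_iff_dvd).2 (by push_cast; exact h3)
    have h5 := h4.gcd_eq
    rw [Nat.gcd_comm d x, h5, Nat.Coprime.gcd_mul_left_cancel _ h2, Nat.gcd_comm]

theorem h_eq (i j : ℕ) (hi : 0 < i) : h i j =
    ∑ d ∈ (Nat.gcd i j).divisors, (gu (i / d) (j / d) d).card := by
  unfold h
  rw [Finset.sum_filter]
  apply Finset.sum_congr rfl
  intro d hd
  rw [gu_card _ _ _ (Nat.pos_of_mem_divisors hd)]

/-- the subgroup with given parameters -/
def SG (m n : ℕ) (x y d u : ℤ) : AddSubgroup (ZMod m × ZMod n) where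
  carrier := {p | ∃ k l : ℤ, p = (((x * k : ℤ) : ZMod m), ((y * (u * k + d * l) : ℤ) : ZMod n))}
  zero_mem' := ⟨0, 0, by ext <;> simp⟩
  add_mem' := by
    rintro _ _ ⟨k, l, rfl⟩ ⟨k', l', rfl⟩
    refine ⟨k + k', l + l', ?_⟩
    ext
    · simp; ring
    · simp; ring
  neg_mem' := by
    rintro _ ⟨k, l, rfl⟩
    refine ⟨-k, -l, ?_⟩
    ext
    · simp
    · simp; ring

theorem mem_SG (m n : ℕ) (x y d u : ℤ) (h1 : x * d ∣ m) (h2 : y * d ∣ n) (a b : ℤ) :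
    ((a : ZMod m), (b : ZMod n)) ∈ SG m n x y d u ↔
      ∃ k l : ℤ, a = x * k ∧ b = y * (u * k + d * l) := by
  constructor
  · rintro ⟨k, l, hp⟩
    rw [Prod.mk.injEq, ZMod.intCast_eq_intCast_iff_dvd_sub,
      ZMod.intCast_eq_intCast_iff_dvd_sub] at hp
    obtain ⟨⟨s, hs⟩, ⟨r, hr⟩⟩ := hp
    obtain ⟨m', hm⟩ := h1
    obtain ⟨n', hn⟩ := h2
    rw [hm] at hs
    rw [hn] at hr
    refine ⟨k - d * m' * s, l - n' * r + u * m' * s, ?_, ?_⟩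
    · linear_combination -hs
    · linear_combination -hr
  · rintro ⟨k, l, rfl, rfl⟩
    exact ⟨k, l, rfl⟩

theorem SG_mul (m n : ℕ) (x y d u : ℤ) (hu : d ∣ u * y - x) :
    ∀ p ∈ SG m n x y d u, ∀ q ∈ SG m n x y d u, p * q ∈ SG m n x y d u := by
  rintro _ ⟨k, l, rfl⟩ _ ⟨k', l', rfl⟩
  obtain ⟨s, hs⟩ := hu
  have hx : x = u * y - d * s := by linear_combination -hs
  refine ⟨x * k * k', y * (u * k * l' + u * k' * l + d * l * l') + u * s * k * k', ?_⟩
  rw [Prod.mk_mul_mk, ← Int.cast_mul, ← Int.cast_mul]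
  congr 2
  · ring
  · rw [hx]; ring

theorem SG_le (m n : ℕ) (x y d u x' y' d' u' : ℤ)
    (h1 : x * d ∣ m) (h2 : y * d ∣ n) (h1' : x' * d' ∣ m) (h2' : y' * d' ∣ n)
    (hx : 0 < x') (hy : 0 < y')
    (hc : IsCoprime u d) (hc' : IsCoprime u' d')
    (hle : SG m n x y d u ≤ SG m n x' y' d' u') :
    x' ∣ x ∧ y' ∣ y ∧ (x = x' → d' ∣ d) ∧ (x = x' → y = y' → d' ∣ u - u') := by
  have key : ∀ k l : ℤ, ∃ k' l' : ℤ, x * k = x' * k' ∧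
      y * (u * k + d * l) = y' * (u' * k' + d' * l') := fun k l =>
    (mem_SG m n x' y' d' u' h1' h2' _ _).1
      (hle ((mem_SG m n x y d u h1 h2 _ _).2 ⟨k, l, rfl, rfl⟩))
  refine ⟨?_, ?_, ?_, ?_⟩
  · obtain ⟨k', l', h, -⟩ := key 1 0
    exact ⟨k', by linarith⟩
  · obtain ⟨a, b, hab⟩ := hc
    obtain ⟨k', l', -, h⟩ := key a b
    exact ⟨_, by rw [← h]; linear_combination -y * hab⟩
  · rintro rfl
    obtain ⟨k', l', h, h'⟩ := key d (-u)
    have hk : d = k' := mul_left_cancel₀ hx.ne' h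
    subst hk
    have : u' * d + d' * l' = 0 := by
      have : y' * (u' * d + d' * l') = 0 := by rw [← h']; ring
      exact (mul_eq_zero.1 this).resolve_left hy.ne'
    exact hc'.symm.dvd_of_dvd_mul_left ⟨-l', by linarith⟩
  · rintro rfl rfl
    obtain ⟨k', l', h, h'⟩ := key 1 0
    have hk : 1 = k' := mul_left_cancel₀ hx.ne' h
    subst hk
    have := mul_left_cancel₀ hy.ne' h'
    exact ⟨l', by linarith⟩

theorem exists_gen (P : ℤ → Prop) (h0 : P 0) (ha : ∀ a b, P a → P b → P (a + b))
    (hn : ∀ a, P a → P (-a)) (N : ℕ) (hN : 0 < N) (hP : P N) :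
    ∃ g : ℕ, 0 < g ∧ ∀ a, P a ↔ (g : ℤ) ∣ a := by
  let H : AddSubgroup ℤ :=
    { carrier := {a | P a}
      zero_mem' := h0
      add_mem' := fun {a b} => ha a b
      neg_mem' := fun {a} => hn a }
  obtain ⟨g, hg⟩ := Int.subgroup_cyclic H
  have hm : ∀ a, P a ↔ g ∣ a := by
    intro a
    change a ∈ H ↔ _
    rw [hg, ← AddSubgroup.zmultiples_eq_closure, Int.mem_zmultiples_iff]
  refine ⟨g.natAbs, ?_, ?_⟩
  · rw [Int.natAbs_pos]
    rintro rfl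
    have := (hm N).1 hP
    simp at this
    omega
  · intro a
    rw [hm, Int.natAbs_dvd]

theorem SG_surj (m n : ℕ) (hm : 0 < m) (hn : 0 < n) (S : AddSubgroup (ZMod m × ZMod n))
    (hS : ∀ x ∈ S, ∀ y ∈ S, x * y ∈ S) :
    ∃ x y d u : ℕ, 0 < x ∧ 0 < y ∧ 0 < d ∧ x * d ∣ m ∧ y * d ∣ n ∧ u ∈ gu x y d ∧
      SG m n x y d u = S := by
  let K : ℤ → ℤ → Prop := fun a b => ((a : ZMod m), (b : ZMod n)) ∈ S
  have K0 : K 0 0 := by simp [K, ← Prod.zero_eq_mk]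
  have Ka : ∀ a b a' b', K a b → K a' b' → K (a + a') (b + b') := by
    intro a b a' b' h h'
    simpa [K] using S.add_mem h h'
  have Kn : ∀ a b, K a b → K (-a) (-b) := by
    intro a b h
    simpa [K] using S.neg_mem h
  have Kz : ∀ k a b, K a b → K (k * a) (k * b) := by
    intro k a b h
    simpa [K] using S.zsmul_mem h k
  have Km : K m 0 := by simp [K, ← Prod.zero_eq_mk]
  have Kn' : K 0 n := by simp [K, ← Prod.zero_eq_mk]
  have Kmul : ∀ a b a' b', K a b → K a' b' → K (a * a') (b * b') := by
    intro a b a' b' h h'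
    simpa [K] using hS _ h _ h'
  obtain ⟨x, hx0, hx⟩ := exists_gen (fun a => ∃ b, K a b) ⟨0, K0⟩
    (fun a b ⟨c, hc⟩ ⟨c', hc'⟩ => ⟨_, Ka _ _ _ _ hc hc'⟩) (fun a ⟨c, hc⟩ => ⟨_, Kn _ _ hc⟩)
    m hm ⟨0, Km⟩
  obtain ⟨y, hy0, hy⟩ := exists_gen (fun b => ∃ a, K a b) ⟨0, K0⟩
    (fun a b ⟨c, hc⟩ ⟨c', hc'⟩ => ⟨_, Ka _ _ _ _ hc hc'⟩) (fun a ⟨c, hc⟩ => ⟨_, Kn _ _ hc⟩)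
    n hn ⟨0, Kn'⟩
  obtain ⟨z, hz0, hz⟩ := exists_gen (fun b => K 0 b) K0
    (fun a b hc hc' => by simpa using Ka _ _ _ _ hc hc') (fun a hc => by simpa using Kn _ _ hc)
    n hn Kn'
  have hyz : (y : ℤ) ∣ z := (hy _).1 ⟨0, (hz _).2 dvd_rfl⟩
  obtain ⟨d, rfl⟩ := Int.natCast_dvd_natCast.1 hyz
  have hd0 : 0 < d := Nat.pos_of_mul_pos_left hz0
  have hdZ : (0 : ℤ) < d := by exact_mod_cast hd0
  obtain ⟨c, hc⟩ := (hx x).2 dvd_rfl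
  obtain ⟨v, rfl⟩ := (hy c).1 ⟨_, hc⟩
  have huc : (((v % d).toNat : ℕ) : ℤ) = v % d := Int.toNat_of_nonneg (Int.emod_nonneg _ hdZ.ne')
  obtain ⟨u, hu⟩ : ∃ u : ℕ, u = (v % d).toNat := ⟨_, rfl⟩
  rw [← hu] at huc
  have hul : u < d := by
    have := Int.emod_lt_of_pos v hdZ
    omega
  have hxu : K x (y * u) := by
    have h1 : K 0 ((y * d : ℕ) * (-(v / d))) := (hz _).2 (dvd_mul_right _ _)
    have h2 := Ka _ _ _ _ hc h1
    have h3 := Int.emod_add_mul_ediv v d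
    rw [huc]
    convert h2 using 1
    · ring
    · push_cast
      linear_combination (y : ℤ) * h3
  have Kiff : ∀ a b, K a b ↔ ∃ k l : ℤ, a = x * k ∧ b = y * (u * k + d * l) := by
    intro a b
    constructor
    · intro h
      obtain ⟨k, rfl⟩ := (hx a).1 ⟨b, h⟩
      have h1 := Ka _ _ _ _ h (Kz (-k) _ _ hxu)
      rw [show (x : ℤ) * k + -k * x = 0 by ring] at h1
      obtain ⟨l, hl⟩ := (hz _).1 h1
      push_cast at hl
      exact ⟨k, l, rfl, by linear_combination hl⟩
    · rintro ⟨k, l, rfl, rfl⟩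
      have h1 : K 0 ((y * d : ℕ) * l) := (hz _).2 (dvd_mul_right _ _)
      convert Ka _ _ _ _ (Kz k _ _ hxu) h1 using 1
      · ring
      · push_cast
        ring
  have hxZ : (x : ℤ) ≠ 0 := by exact_mod_cast hx0.ne'
  have hyZ : (y : ℤ) ≠ 0 := by exact_mod_cast hy0.ne'
  have hcop : IsCoprime (u : ℤ) d := by
    obtain ⟨a, ha⟩ := (hy y).2 dvd_rfl
    obtain ⟨k, l, -, h⟩ := (Kiff _ _).1 ha
    refine ⟨k, l, ?_⟩
    apply mul_left_cancel₀ hyZ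
    linear_combination -h
  have hxd : x * d ∣ m := by
    obtain ⟨k, l, h, h'⟩ := (Kiff _ _).1 Km
    have h2 : (u * k + d * l : ℤ) = 0 := (mul_eq_zero.1 h'.symm).resolve_left hyZ
    obtain ⟨r, hr⟩ : (d : ℤ) ∣ k := hcop.symm.dvd_of_dvd_mul_left ⟨-l, by linarith⟩
    have : ((x * d : ℕ) : ℤ) ∣ m := ⟨r, by rw [h, hr]; push_cast; ring⟩
    exact_mod_cast this
  have hyd : y * d ∣ n := by
    exact_mod_cast (hz _).1 Kn'
  have hmul : (d : ℤ) ∣ u * y - x := by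
    obtain ⟨k, l, h, h'⟩ := (Kiff _ _).1 (Kmul _ _ _ _ hxu hxu)
    have hk : (x : ℤ) = k := mul_left_cancel₀ hxZ h
    subst hk
    apply hcop.symm.dvd_of_dvd_mul_left
    refine ⟨l, ?_⟩
    apply mul_left_cancel₀ hyZ
    linear_combination h'
  refine ⟨x, y, d, u, hx0, hy0, hd0, hxd, hyd, ?_, ?_⟩
  · simp only [gu, Finset.mem_filter, Finset.mem_range]
    exact ⟨hul, Nat.isCoprime_iff_coprime.1 hcop, hmul⟩
  · ext ⟨p, q⟩
    obtain ⟨a, rfl⟩ := ZMod.intCast_surjective p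
    obtain ⟨b, rfl⟩ := ZMod.intCast_surjective q
    rw [mem_SG m n x y d u (by exact_mod_cast hxd) (by exact_mod_cast hyd)]
    exact (Kiff a b).symm

/-- parameters -/
def TT (m n : ℕ) : Finset (Σ _ : ℕ, Σ _ : ℕ, Σ _ : ℕ, ℕ) :=
  m.divisors.sigma fun i => n.divisors.sigma fun j => (Nat.gcd i j).divisors.sigma fun d =>
    gu (i / d) (j / d) d

theorem TT_card (m n : ℕ) : (TT m n).card = ∑ i ∈ m.divisors, ∑ j ∈ n.divisors, h i j := by
  unfold TT
  rw [Finset.card_sigma]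
  apply Finset.sum_congr rfl
  intro i hi
  rw [Finset.card_sigma]
  apply Finset.sum_congr rfl
  intro j hj
  rw [Finset.card_sigma, h_eq _ _ (Nat.pos_of_mem_divisors hi)]

theorem TT_mem (m n i j d u : ℕ) (hm : 0 < m) (hn : 0 < n) (ht : ⟨i, j, d, u⟩ ∈ TT m n) :
    0 < d ∧ ∃ x y, 0 < x ∧ 0 < y ∧ i = x * d ∧ j = y * d ∧ i / d = x ∧ j / d = y ∧ x * d ∣ m ∧
      y * d ∣ n ∧ u ∈ gu x y d := by
  simp only [TT, Finset.mem_sigma] at ht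
  obtain ⟨hi, hj, hd, hu⟩ := ht
  have hd0 := Nat.pos_of_mem_divisors hd
  have hi0 := Nat.pos_of_mem_divisors hi
  have hj0 := Nat.pos_of_mem_divisors hj
  have hdd := Nat.dvd_of_mem_divisors hd
  have hdi := hdd.trans (Nat.gcd_dvd_left _ _)
  have hdj := hdd.trans (Nat.gcd_dvd_right _ _)
  refine ⟨hd0, i / d, j / d, Nat.div_pos (Nat.le_of_dvd hi0 hdi) hd0,
    Nat.div_pos (Nat.le_of_dvd hj0 hdj) hd0, (Nat.div_mul_cancel hdi).symm,
    (Nat.div_mul_cancel hdj).symm, rfl, rfl, ?_, ?_, hu⟩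
  · rw [Nat.div_mul_cancel hdi]; exact Nat.dvd_of_mem_divisors hi
  · rw [Nat.div_mul_cancel hdj]; exact Nat.dvd_of_mem_divisors hj

theorem mem_gu {x y d u : ℕ} (hu : u ∈ gu x y d) :
    u < d ∧ IsCoprime (u : ℤ) d ∧ (d : ℤ) ∣ u * y - x := by
  simp only [gu, Finset.mem_filter, Finset.mem_range] at hu
  exact ⟨hu.1, Nat.isCoprime_iff_coprime.2 hu.2.1, hu.2.2⟩

theorem count_subrings (m n : ℕ) (hm : 0 < m) (hn : 0 < n) :
    Nat.card {S : AddSubgroup (ZMod m × ZMod n) // ∀ x ∈ S, ∀ y ∈ S, x * y ∈ S}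
      = ∑ i ∈ m.divisors, ∑ j ∈ n.divisors, h i j := by
  rw [← TT_card, ← Nat.card_eq_finsetCard]
  symm
  let f : (TT m n) →
      {S : AddSubgroup (ZMod m × ZMod n) // ∀ x ∈ S, ∀ y ∈ S, x * y ∈ S} := fun t =>
    ⟨SG m n ((t.1.1 / t.1.2.2.1 : ℕ) : ℤ) ((t.1.2.1 / t.1.2.2.1 : ℕ) : ℤ) (t.1.2.2.1 : ℤ)
      (t.1.2.2.2 : ℤ), by
      obtain ⟨⟨i, j, d, u⟩, ht⟩ := t
      obtain ⟨hd, x, y, hx, hy, hi, hj, hix, hjy, hxm, hyn, hu⟩ := TT_mem m n i j d u hm hn ht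
      apply SG_mul
      simp only
      rw [hix, hjy]
      exact (mem_gu hu).2.2⟩
  apply Nat.card_congr (Equiv.ofBijective f ⟨?_, ?_⟩)
  · rintro ⟨⟨i, j, d, u⟩, ht⟩ ⟨⟨i', j', d', u'⟩, ht'⟩ hff
    obtain ⟨hd, x, y, hx, hy, hi, hj, hix, hjy, hxm, hyn, hu⟩ := TT_mem m n i j d u hm hn ht
    obtain ⟨hd', x', y', hx', hy', hi', hj', hix', hjy', hxm', hyn', hu'⟩ :=
      TT_mem m n i' j' d' u' hm hn ht'
    have hff := congrArg Subtype.val hff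
    simp only [f, hix, hjy, hix', hjy'] at hff
    obtain ⟨hul, huc, -⟩ := mem_gu hu
    obtain ⟨hul', huc', -⟩ := mem_gu hu'
    obtain ⟨a1, a2, a3, a4⟩ := SG_le m n x y d u x' y' d' u' (by exact_mod_cast hxm)
      (by exact_mod_cast hyn) (by exact_mod_cast hxm') (by exact_mod_cast hyn')
      (by exact_mod_cast hx') (by exact_mod_cast hy') huc huc' hff.le
    obtain ⟨b1, b2, b3, b4⟩ := SG_le m n x' y' d' u' x y d u (by exact_mod_cast hxm')
      (by exact_mod_cast hyn') (by exact_mod_cast hxm) (by exact_mod_cast hyn)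
      (by exact_mod_cast hx) (by exact_mod_cast hy) huc' huc hff.ge
    have ex : x = x' := Nat.dvd_antisymm (by exact_mod_cast b1) (by exact_mod_cast a1)
    have ey : y = y' := Nat.dvd_antisymm (by exact_mod_cast b2) (by exact_mod_cast a2)
    subst ex ey
    have ed : d = d' := Nat.dvd_antisymm (by exact_mod_cast b3 rfl) (by exact_mod_cast a3 rfl)
    subst ed
    have eu : u = u' := by
      have := Int.eq_zero_of_abs_lt_dvd (a4 rfl rfl) (by rw [abs_lt]; omega)
      omega
    subst eu
    subst hi hj hi' hj'
    rfl
  · rintro ⟨S, hS⟩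
    obtain ⟨x, y, d, u, hx, hy, hd, hxm, hyn, hu, rfl⟩ := SG_surj m n hm hn S hS
    refine ⟨⟨⟨x * d, y * d, d, u⟩, ?_⟩, ?_⟩
    · simp only [TT, Finset.mem_coe, Finset.mem_sigma, Nat.mem_divisors]
      refine ⟨⟨hxm, hm.ne'⟩, ⟨hyn, hn.ne'⟩,
        ⟨Nat.dvd_gcd (dvd_mul_left _ _) (dvd_mul_left _ _), ?_⟩, ?_⟩
      · exact (Nat.gcd_pos_of_pos_left _ (by positivity)).ne'
      · rw [Nat.mul_div_cancel _ hd, Nat.mul_div_cancel _ hd]; exact hu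
    · apply Subtype.ext
      simp only [f, Nat.mul_div_cancel _ hd]
end

section
/- For a prime p and γ ≥ 0, the number of subrings of the ring ℤ_{p^{2γ}} × ℤ_{p^{2γ}} equals p^γ + 10·∑_{j=1}^{γ} j·p^{γ−j}. -/
namespace CSub

def g (p N i j : ℕ) : ℕ := if j ≤ 2 * i then p ^ (min (j / 2) (N - i)) else 2 * p ^ i

lemma g_shift (p N i j : ℕ) (hi : i ≤ N) : g p (N + 2) (i + 1) (j + 2) = p * g p N i j := by
  unfold g
  have h1 : (j + 2 ≤ 2 * (i + 1)) ↔ j ≤ 2 * i := by omega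
  have h2 : min ((j + 2) / 2) (N + 2 - (i + 1)) = min (j / 2) (N - i) + 1 := by omega
  simp only [h1, h2]
  split_ifs <;> ring

lemma sum_g_step (p N : ℕ) :
    ∑ i ∈ Finset.range (N + 3), ∑ j ∈ Finset.range (N + 3), g p (N + 2) i j
      = p * (∑ i ∈ Finset.range (N + 1), ∑ j ∈ Finset.range (N + 1), g p N i j) + (5 * N + 10) := by
  rw [Finset.sum_range_succ, Finset.sum_range_succ']
  have hlast : ∑ j ∈ Finset.range (N + 3), g p (N + 2) (N + 2) j = N + 3 := by
    rw [Finset.sum_congr rfl (g := fun _ => 1)]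
    · simp
    · intro j hj
      have := Finset.mem_range.1 hj
      unfold g
      rw [if_pos (by omega)]
      simp
  have h0 : ∑ j ∈ Finset.range (N + 3), g p (N + 2) 0 j = 2 * (N + 2) + 1 := by
    rw [Finset.sum_range_succ', Finset.sum_congr rfl (g := fun _ => 2)]
    · simp [g]; ring
    · intro j hj
      simp [g]
  have hm : ∑ i ∈ Finset.range (N + 1), ∑ j ∈ Finset.range (N + 3), g p (N + 2) (i + 1) j
      = ∑ i ∈ Finset.range (N + 1), (p * ∑ j ∈ Finset.range (N + 1), g p N i j + 2) := by
    apply Finset.sum_congr rfl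
    intro i hi
    have := Finset.mem_range.1 hi
    rw [Finset.sum_range_succ', Finset.sum_range_succ', Finset.mul_sum]
    have e0 : g p (N + 2) (i + 1) 0 = 1 := by simp [g]
    have e1 : g p (N + 2) (i + 1) (0 + 1) = 1 := by
      unfold g
      rw [if_pos (by omega)]; simp
    rw [e0, e1, add_assoc]
    congr 1
    apply Finset.sum_congr rfl
    intro j _
    exact g_shift p N i j (by omega)
  rw [hlast, h0, hm, Finset.sum_add_distrib, ← Finset.mul_sum]
  simp
  ring

lemma sum_g (p γ : ℕ) :
    ∑ i ∈ Finset.range (2 * γ + 1), ∑ j ∈ Finset.range (2 * γ + 1), g p (2 * γ) i j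
      = p ^ γ + 10 * ∑ j ∈ Finset.Icc 1 γ, j * p ^ (γ - j) := by
  induction γ with
  | zero => simp [g]
  | succ n ih =>
    rw [show 2 * (n + 1) + 1 = 2 * n + 3 by ring, show 2 * (n + 1) = 2 * n + 2 by ring,
      sum_g_step, ih, Finset.sum_Icc_succ_top (by omega)]
    have : ∑ j ∈ Finset.Icc 1 n, j * p ^ (n + 1 - j) = p * ∑ j ∈ Finset.Icc 1 n, j * p ^ (n - j) := by
      rw [Finset.mul_sum]
      apply Finset.sum_congr rfl
      intro j hj
      have := Finset.mem_Icc.1 hj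
      rw [show n + 1 - j = (n - j) + 1 by omega]
      ring
    rw [this]
    simp
    ring

lemma card_mod (m q r : ℕ) (hr : r < m) :
    ((Finset.range (m * q)).filter (fun t : ℕ => (m : ℤ) ∣ (t : ℤ) - (r : ℕ))).card = q := by
  have : (Finset.range (m * q)).filter (fun t : ℕ => (m : ℤ) ∣ (t : ℤ) - (r : ℕ))
      = (Finset.range q).image (fun k => m * k + r) := by
    ext t
    simp only [Finset.mem_filter, Finset.mem_range, Finset.mem_image]
    constructor
    · rintro ⟨h1, h2⟩
      have h3 : r ≡ t [MOD m] := (Nat.modEq_iff_dvd).2 h2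
      have h4 : t % m = r := by
        rw [← h3, Nat.mod_eq_of_lt hr]
      exact ⟨t / m, Nat.div_lt_of_lt_mul h1, by rw [← h4]; exact Nat.div_add_mod t m⟩
    · rintro ⟨k, hk, rfl⟩
      refine ⟨?_, by push_cast; simp⟩
      calc m * k + r < m * k + m := by omega
        _ = m * (k + 1) := by ring
        _ ≤ m * q := Nat.mul_le_mul_left _ hk
  rw [this, Finset.card_image_of_injective, Finset.card_range]
  intro a b hab
  have : m * a = m * b := by simpa using hab
  exact Nat.eq_of_mul_eq_mul_left (by omega) this

lemma split_pow {p : ℕ} (hp : p.Prime) {j : ℕ} {x y : ℤ} (h : (p : ℤ) ^ j ∣ x * y) :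
    ∃ a b, a + b = j ∧ (p : ℤ) ^ a ∣ x ∧ (p : ℤ) ^ b ∣ y := by
  have h' : p ^ j ∣ x.natAbs * y.natAbs := by
    rw [← Int.natAbs_mul]
    exact Int.natCast_dvd.1 (by exact_mod_cast h)
  obtain ⟨u, v, hu, hv, huv⟩ := exists_dvd_and_dvd_of_dvd_mul h'
  obtain ⟨a, _, rfl⟩ := (Nat.dvd_prime_pow hp).1 (Dvd.intro _ huv.symm)
  obtain ⟨b, _, rfl⟩ := (Nat.dvd_prime_pow hp).1 (Dvd.intro_left _ huv.symm)
  refine ⟨a, b, ?_, ?_, ?_⟩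
  · rw [← pow_add] at huv
    exact (Nat.pow_right_injective hp.two_le huv).symm
  · exact_mod_cast Int.natCast_dvd.2 hu
  · exact_mod_cast Int.natCast_dvd.2 hv

def C (p N i j t : ℕ) : Prop :=
  (p : ℤ) ^ j ∣ (t : ℤ) * (p : ℤ) ^ (N - i) ∧ (p : ℤ) ^ j ∣ (t : ℤ) * ((t : ℤ) - (p : ℤ) ^ i)

instance (p N i j : ℕ) : DecidablePred (C p N i j) := fun t => by unfold C; infer_instance

lemma card_C {p : ℕ} (hp : p.Prime) (N i j : ℕ) (hi : i ≤ N) (hj : j ≤ N) :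
    ((Finset.range (p ^ j)).filter (C p N i j)).card = g p N i j := by
  have hp0 : (p : ℤ) ≠ 0 := by exact_mod_cast hp.ne_zero
  unfold g
  split_ifs with hij
  · have key : ∀ t : ℕ, C p N i j t ↔
        ((p ^ (j - min (j / 2) (N - i)) : ℕ) : ℤ) ∣ (t : ℤ) - (0 : ℕ) := by
      intro t
      push_cast
      rw [sub_zero]
      constructor
      · rintro ⟨h1, h2⟩
        rcases le_total (j / 2) (N - i) with h | h
        · rw [min_eq_left h]
          obtain ⟨a, b, hab, ha, hb⟩ := split_pow hp h2
          rcases le_or_gt (j - j / 2) a with h3 | h3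
          · exact (pow_dvd_pow _ h3).trans ha
          · have := dvd_add ((pow_dvd_pow (p : ℤ) (show j - j / 2 ≤ b by omega)).trans hb)
              (pow_dvd_pow (p : ℤ) (show j - j / 2 ≤ i by omega))
            simpa using this
        · rw [min_eq_right h]
          rw [show (p : ℤ) ^ j = p ^ (j - (N - i)) * p ^ (N - i) by
            rw [← pow_add]; congr 1; omega] at h1
          exact Int.dvd_of_mul_dvd_mul_right (pow_ne_zero _ hp0) h1
      · intro h
        constructor
        · have := mul_dvd_mul_right h ((p : ℤ) ^ (N - i))
          rw [← pow_add] at this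
          exact (pow_dvd_pow _ (by omega)).trans this
        · have h1 : (p : ℤ) ^ (j - j / 2) ∣ t := (pow_dvd_pow _ (by omega)).trans h
          have h2 := mul_dvd_mul h1
            (dvd_sub h1 (pow_dvd_pow (p : ℤ) (show j - j / 2 ≤ i by omega)))
          rw [← pow_add] at h2
          exact (pow_dvd_pow _ (by omega)).trans h2
    rw [Finset.filter_congr (fun t _ => key t)]
    have := card_mod (p ^ (j - min (j / 2) (N - i))) (p ^ (min (j / 2) (N - i))) 0
      (pow_pos hp.pos _)
    rw [← pow_add, Nat.sub_add_cancel (by omega)] at this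
    exact this
  · push Not at hij
    have hlt : p ^ i < p ^ (j - i) := Nat.pow_lt_pow_right hp.one_lt (by omega)
    have key : ∀ t : ℕ, C p N i j t ↔
        (((p ^ (j - i) : ℕ) : ℤ) ∣ (t : ℤ) - (0 : ℕ) ∨
          ((p ^ (j - i) : ℕ) : ℤ) ∣ (t : ℤ) - (p ^ i : ℕ)) := by
      intro t
      push_cast
      rw [sub_zero]
      constructor
      · rintro ⟨h1, h2⟩
        obtain ⟨a, b, hab, ha, hb⟩ := split_pow hp h2
        rcases le_or_gt a i with h3 | h3
        · exact Or.inr ((pow_dvd_pow _ (by omega)).trans hb)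
        rcases le_or_gt b i with h4 | h4
        · exact Or.inl ((pow_dvd_pow _ (by omega)).trans ha)
        exfalso
        have h5 := dvd_sub ((pow_dvd_pow (p : ℤ) (show i + 1 ≤ a by omega)).trans ha)
          ((pow_dvd_pow (p : ℤ) (show i + 1 ≤ b by omega)).trans hb)
        rw [sub_sub_cancel] at h5
        have h6 : p ^ (i + 1) ∣ p ^ i := by exact_mod_cast h5
        have := (Nat.pow_dvd_pow_iff_le_right hp.one_lt).1 h6
        omega
      · intro h
        have hti : (p : ℤ) ^ i ∣ t := by
          rcases h with h | h
          · exact (pow_dvd_pow _ (by omega)).trans h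
          · have := dvd_add ((pow_dvd_pow (p : ℤ) (show i ≤ j - i by omega)).trans h)
              (dvd_refl ((p : ℤ) ^ i))
            simpa using this
        constructor
        · have := mul_dvd_mul_right hti ((p : ℤ) ^ (N - i))
          rw [← pow_add] at this
          exact (pow_dvd_pow _ (by omega)).trans this
        · rcases h with h | h
          · have := mul_dvd_mul h (dvd_sub hti (dvd_refl ((p : ℤ) ^ i)))
            rw [← pow_add] at this
            exact (pow_dvd_pow _ (by omega)).trans this
          · have := mul_dvd_mul hti h
            rw [← pow_add] at this
            exact (pow_dvd_pow _ (by omega)).trans this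
    rw [Finset.filter_congr (fun t _ => key t), Finset.filter_or, Finset.card_union_of_disjoint]
    · have h1 := card_mod (p ^ (j - i)) (p ^ i) 0 (pow_pos hp.pos _)
      have h2 := card_mod (p ^ (j - i)) (p ^ i) (p ^ i) hlt
      rw [← pow_add, Nat.sub_add_cancel (by omega)] at h1 h2
      rw [h1, h2]; ring
    · rw [Finset.disjoint_filter]
      intro t _ h1 h2
      have := dvd_sub h1 h2
      rw [Nat.cast_zero, sub_zero, sub_sub_cancel] at this
      have h3 : p ^ (j - i) ∣ p ^ i := by exact_mod_cast this
      exact absurd (Nat.le_of_dvd (pow_pos hp.pos _) h3) (by omega)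

/-- The subgroup attached to a triple. -/
def L (n a b t : ℕ) : AddSubgroup (ZMod n × ZMod n) where
  carrier := {z | ∃ k l : ℤ, z = (((k * a : ℤ) : ZMod n), ((k * t + l * b : ℤ) : ZMod n))}
  zero_mem' := ⟨0, 0, by ext <;> simp⟩
  add_mem' := by
    rintro _ _ ⟨k, l, rfl⟩ ⟨k', l', rfl⟩
    refine ⟨k + k', l + l', ?_⟩
    ext <;> (push_cast; simp; ring)
  neg_mem' := by
    rintro _ ⟨k, l, rfl⟩
    refine ⟨-k, -l, ?_⟩
    ext <;> (push_cast; simp) <;> ring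

lemma mem_L {p N i j t : ℕ} (hp : p.Prime) (hi : i ≤ N) (hj : j ≤ N)
    (hc : (p : ℤ) ^ j ∣ (t : ℤ) * (p : ℤ) ^ (N - i)) (x y : ℤ) :
    (((x : ZMod (p ^ N)), (y : ZMod (p ^ N))) ∈ L (p ^ N) (p ^ i) (p ^ j) t) ↔
      ∃ k : ℤ, x = k * p ^ i ∧ (p : ℤ) ^ j ∣ y - k * t := by
  constructor
  · rintro ⟨k, l, h⟩
    rw [Prod.mk.injEq, ZMod.intCast_eq_intCast_iff_dvd_sub, ZMod.intCast_eq_intCast_iff_dvd_sub] at h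
    obtain ⟨⟨u, hu⟩, ⟨v, hv⟩⟩ := h
    push_cast at hu hv
    have e1 : (p : ℤ) ^ N = p ^ (N - i) * p ^ i := by rw [← pow_add]; congr 1; omega
    have e2 : (p : ℤ) ^ N = p ^ (N - j) * p ^ j := by rw [← pow_add]; congr 1; omega
    refine ⟨k - p ^ (N - i) * u, ?_, ?_⟩
    · rw [e1] at hu; linear_combination -hu
    · obtain ⟨w, hw⟩ := hc
      rw [e2] at hv
      exact ⟨l - p ^ (N - j) * v + w * u, by linear_combination -hv + u * hw⟩
  · rintro ⟨k, rfl, l, hl⟩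
    refine ⟨k, l, ?_⟩
    have : y = k * t + l * p ^ j := by linear_combination hl
    subst this
    push_cast
    rfl

lemma exists_gen {p : ℕ} (hp : p.Prime) (N : ℕ) (H : AddSubgroup ℤ) (h : (p : ℤ) ^ N ∈ H) :
    ∃ i ≤ N, ∀ x, x ∈ H ↔ (p : ℤ) ^ i ∣ x := by
  obtain ⟨a, ha⟩ := Int.subgroup_cyclic H
  have hm : ∀ x, x ∈ H ↔ a ∣ x := by
    intro x
    rw [ha, ← AddSubgroup.zmultiples_eq_closure, Int.mem_zmultiples_iff]
  have h1 := (hm _).1 h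
  have h2 : a.natAbs ∣ p ^ N := by
    have := Int.natAbs_dvd_natAbs.2 h1
    simpa [Int.natAbs_pow] using this
  obtain ⟨i, hi, hai⟩ := (Nat.dvd_prime_pow hp).1 h2
  refine ⟨i, hi, fun x => ?_⟩
  rw [hm, ← Int.natAbs_dvd, hai]
  push_cast
  rfl

def T (p N : ℕ) : Finset (Σ _ : ℕ × ℕ, ℕ) :=
  (Finset.range (N + 1) ×ˢ Finset.range (N + 1)).sigma
    (fun ij => (Finset.range (p ^ ij.2)).filter (C p N ij.1 ij.2))

lemma card_T {p : ℕ} (hp : p.Prime) (N : ℕ) :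
    (T p N).card = ∑ i ∈ Finset.range (N + 1), ∑ j ∈ Finset.range (N + 1), g p N i j := by
  unfold T
  rw [Finset.card_sigma, Finset.sum_product]
  apply Finset.sum_congr rfl
  intro i hi
  apply Finset.sum_congr rfl
  intro j hj
  rw [Finset.mem_range] at hi hj
  exact card_C hp N i j (by omega) (by omega)

lemma mem_T {p N i j t : ℕ} : (⟨(i, j), t⟩ : Σ _ : ℕ × ℕ, ℕ) ∈ T p N ↔
    i ≤ N ∧ j ≤ N ∧ t < p ^ j ∧ C p N i j t := by
  simp [T, Nat.lt_succ_iff, and_assoc]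

def F (p N : ℕ) (s : Σ _ : ℕ × ℕ, ℕ) : AddSubgroup (ZMod (p ^ N) × ZMod (p ^ N)) :=
  L (p ^ N) (p ^ s.1.1) (p ^ s.1.2) s.2

lemma bij {p : ℕ} (hp : p.Prime) (N : ℕ) :
    Set.BijOn (F p N) (T p N) {S | ∀ x ∈ S, ∀ y ∈ S, x * y ∈ S} := by
  have surjc : ∀ z : ZMod (p ^ N) × ZMod (p ^ N), ∃ x y : ℤ, z = ((x : ZMod (p ^ N)), (y : ZMod (p ^ N))) := by
    rintro ⟨a, b⟩
    obtain ⟨x, rfl⟩ := ZMod.intCast_surjective a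
    obtain ⟨y, rfl⟩ := ZMod.intCast_surjective b
    exact ⟨x, y, rfl⟩
  refine ⟨?_, ?_, ?_⟩
  · rintro ⟨⟨i, j⟩, t⟩ hs
    obtain ⟨hi, hj, ht, hc, hd⟩ := mem_T.1 hs
    intro z hz w hw
    obtain ⟨x, y, rfl⟩ := surjc z
    obtain ⟨x', y', rfl⟩ := surjc w
    obtain ⟨k, hk, l, hl⟩ := (mem_L hp hi hj hc x y).1 hz
    obtain ⟨k', hk', l', hl'⟩ := (mem_L hp hi hj hc x' y').1 hw
    rw [Prod.mk_mul_mk, ← Int.cast_mul, ← Int.cast_mul]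
    refine (mem_L hp hi hj hc _ _).2 ⟨k * k' * p ^ i, by rw [hk, hk']; ring, ?_⟩
    obtain ⟨w, hw⟩ := hd
    exact ⟨k * k' * w + l * y' + k * t * l',
      by linear_combination k * k' * hw + y' * hl + k * t * hl'⟩
  · rintro ⟨⟨i, j⟩, t⟩ hs ⟨⟨i', j'⟩, t'⟩ hs' heq
    obtain ⟨hi, hj, ht, hc, -⟩ := mem_T.1 hs
    obtain ⟨hi', hj', ht', hc', -⟩ := mem_T.1 hs'
    have hiff : ∀ x y : ℤ, (∃ k : ℤ, x = k * p ^ i ∧ (p : ℤ) ^ j ∣ y - k * t) ↔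
        (∃ k : ℤ, x = k * p ^ i' ∧ (p : ℤ) ^ j' ∣ y - k * t') := by
      intro x y
      rw [← mem_L hp hi hj hc, ← mem_L hp hi' hj' hc']
      have heq' : L (p ^ N) (p ^ i) (p ^ j) t = L (p ^ N) (p ^ i') (p ^ j') t' := heq
      rw [heq']
    have hpz : ∀ a : ℕ, (p : ℤ) ^ a ≠ 0 := fun a => pow_ne_zero _ (by exact_mod_cast hp.ne_zero)
    have dle : ∀ a b : ℕ, (p : ℤ) ^ a ∣ (p : ℤ) ^ b → a ≤ b := by
      intro a b h
      exact (Nat.pow_dvd_pow_iff_le_right hp.one_lt).1 (by exact_mod_cast h)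
    have h1 : i = i' := by
      obtain ⟨k, hk, -⟩ := (hiff (p ^ i) t).1 ⟨1, by simp, by simp⟩
      obtain ⟨k', hk', -⟩ := (hiff (p ^ i') t').2 ⟨1, by simp, by simp⟩
      exact le_antisymm (dle _ _ ⟨k', by rw [hk']; ring⟩) (dle _ _ ⟨k, by rw [hk]; ring⟩)
    subst h1
    have h2 : j = j' := by
      obtain ⟨k, hk, h⟩ := (hiff 0 (p ^ j)).1 ⟨0, by simp, by simp⟩
      obtain ⟨k', hk', h'⟩ := (hiff 0 (p ^ j')).2 ⟨0, by simp, by simp⟩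
      have e : k = 0 := by simpa [hpz i, hp.ne_zero] using hk.symm
      have e' : k' = 0 := by simpa [hpz i, hp.ne_zero] using hk'.symm
      subst e e'
      exact le_antisymm (dle _ _ (by simpa using h')) (dle _ _ (by simpa using h))
    subst h2
    have h3 : t = t' := by
      obtain ⟨k, hk, h⟩ := (hiff (p ^ i) t).1 ⟨1, by simp, by simp⟩
      have e : k = 1 := by
        apply mul_right_cancel₀ (hpz i)
        rw [← hk, one_mul]
      subst e
      rw [one_mul] at h
      have : t' ≡ t [MOD p ^ j] := Nat.modEq_iff_dvd.2 (by exact_mod_cast h)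
      exact (Nat.ModEq.eq_of_lt_of_lt this ht' ht).symm
    subst h3
    rfl
  · intro S hS
    let A : AddSubgroup ℤ := (S.map (AddMonoidHom.fst _ _)).comap (Int.castAddHom (ZMod (p ^ N)))
    let B : AddSubgroup ℤ := S.comap ((AddMonoidHom.inr (ZMod (p ^ N)) (ZMod (p ^ N))).comp (Int.castAddHom (ZMod (p ^ N))))
    have hA : ∀ x : ℤ, x ∈ A ↔ ∃ y : ℤ, ((x : ZMod (p ^ N)), (y : ZMod (p ^ N))) ∈ S := by
      intro x
      constructor
      · rintro ⟨⟨a, b⟩, h1, h2⟩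
        obtain ⟨y, rfl⟩ := ZMod.intCast_surjective b
        refine ⟨y, ?_⟩
        have h3 : a = (x : ZMod (p ^ N)) := h2
        rw [← h3]; exact h1
      · rintro ⟨y, hy⟩
        exact ⟨_, hy, rfl⟩
    have hB : ∀ y : ℤ, y ∈ B ↔ ((0 : ZMod (p ^ N)), (y : ZMod (p ^ N))) ∈ S := fun y => Iff.rfl
    have hz : (((p : ℤ) ^ N : ℤ) : ZMod (p ^ N)) = 0 := by
      have := ZMod.natCast_self (p ^ N)
      exact_mod_cast this
    obtain ⟨i, hi, hAi⟩ := exists_gen hp N A ((hA _).2 ⟨0, by rw [hz, Int.cast_zero]; exact S.zero_mem⟩)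
    obtain ⟨j, hj, hBj⟩ := exists_gen hp N B ((hB _).2 (by rw [hz]; exact S.zero_mem))
    obtain ⟨t₀, ht₀⟩ := (hA _).1 ((hAi _).2 (dvd_refl ((p : ℤ) ^ i)))
    have hpj : (0 : ℤ) < (p : ℤ) ^ j := pow_pos (by exact_mod_cast hp.pos) _
    obtain ⟨t, ht⟩ := Int.eq_ofNat_of_zero_le (Int.emod_nonneg t₀ hpj.ne')
    have htlt : t < p ^ j := by
      have := Int.emod_lt_of_pos t₀ hpj
      rw [ht] at this
      exact_mod_cast this
    have hbm : ∀ y : ℤ, (p : ℤ) ^ j ∣ y → ((0 : ZMod (p ^ N)), (y : ZMod (p ^ N))) ∈ S :=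
      fun y h => (hB y).1 ((hBj y).2 h)
    have hmb : ∀ y : ℤ, ((0 : ZMod (p ^ N)), (y : ZMod (p ^ N))) ∈ S → (p : ℤ) ^ j ∣ y :=
      fun y h => (hBj y).1 ((hB y).2 h)
    have hg : ((((p : ℤ) ^ i : ℤ) : ZMod (p ^ N)), ((t : ℤ) : ZMod (p ^ N))) ∈ S := by
      have h1 : (p : ℤ) ^ j ∣ t₀ - t := by
        rw [← ht]; exact Int.dvd_self_sub_emod
      have := S.sub_mem ht₀ (hbm _ h1)
      convert this using 1
      ext <;> simp
    have hk : ∀ k : ℤ, (((k * (p : ℤ) ^ i : ℤ) : ZMod (p ^ N)), ((k * t : ℤ) : ZMod (p ^ N))) ∈ S := by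
      intro k
      have := S.zsmul_mem hg k
      convert this using 1
      ext <;> simp
    have hc1 : (p : ℤ) ^ j ∣ (t : ℤ) * (p : ℤ) ^ (N - i) := by
      apply hmb
      have := hk ((p : ℤ) ^ (N - i))
      rw [← pow_add, Nat.sub_add_cancel hi, hz] at this
      rwa [mul_comm]
    have hc2 : (p : ℤ) ^ j ∣ (t : ℤ) * ((t : ℤ) - (p : ℤ) ^ i) := by
      apply hmb
      have := S.sub_mem (hS _ hg _ hg) (hk ((p : ℤ) ^ i))
      convert this using 1
      ext
      · simp
      · simp; ring
    refine ⟨⟨(i, j), t⟩, mem_T.2 ⟨hi, hj, htlt, hc1, hc2⟩, ?_⟩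
    ext z
    obtain ⟨x, y, rfl⟩ := surjc z
    refine (mem_L hp hi hj hc1 x y).trans ?_
    constructor
    · rintro ⟨k, rfl, h⟩
      have := S.add_mem (hk k) (hbm _ h)
      convert this using 1
      ext <;> simp
    · intro h
      obtain ⟨k, hk'⟩ := (hAi x).1 ((hA x).2 ⟨y, h⟩)
      have hx : x = k * p ^ i := by rw [hk']; ring
      refine ⟨k, hx, hmb _ ?_⟩
      have := S.sub_mem h (hk k)
      convert this using 1
      ext
      · simp [hx]
      · simp

end CSub

theorem count_subrings_even_prime_power (p : ℕ) (hp : p.Prime) (γ : ℕ) :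
    Nat.card {S : AddSubgroup (ZMod (p ^ (2 * γ)) × ZMod (p ^ (2 * γ))) //
        ∀ x ∈ S, ∀ y ∈ S, x * y ∈ S}
      = p ^ γ + 10 * ∑ j ∈ Finset.Icc 1 γ, j * p ^ (γ - j) := by
  rw [← CSub.sum_g, ← CSub.card_T hp]
  have := Nat.card_congr (CSub.bij hp (2 * γ)).equiv
  refine this.symm.trans ?_
  simp
end
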